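/- (Single-task learning, overparameterized regime.) Fix n ≥ 1, a noise level σ ≥ 0, and p ≥ n + 2, and a ground-truth vector w* ∈ ℝᵖ. Let X ∈ ℝ^{p×n} be a random matrix with i.i.d. standard Gaussian N(0,1) entries, let z ∈ ℝⁿ be an independent random vector with i.i.d. N(0,σ²) entries, and let y = Xᵀw* + z. Define the minimum-ℓ₂-norm interpolator w = X(XᵀX)⁻¹y (defined almost surely). Then E[‖w − w*‖₂²] = (1 − n/p)·‖w*‖₂² + n·σ²/(p − n − 1). -/

import Mathlib

open Matrix MeasureTheory ProbabilityTheory NNReal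

/-- The law of a `p × n` random matrix (viewed as `Fin p → Fin n → ℝ`) with i.i.d. standard
Gaussian `N(0,1)` entries. -/
noncomputable def stdGaussianMatrix (p n : ℕ) : Measure (Fin p → Fin n → ℝ) :=
  Measure.pi fun _ => Measure.pi fun _ => gaussianReal 0 1

/-- The law of a noise vector in `ℝⁿ` with i.i.d. `N(0, σ²)` entries. -/
noncomputable def gaussianNoise (n : ℕ) (σ : ℝ≥0) : Measure (Fin n → ℝ) :=
  Measure.pi fun _ => gaussianReal 0 (σ ^ 2)

/-- Laplace transform of the square of a standard Gaussian variable. -/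
lemma integral_exp_neg_sq_gaussianReal {c : ℝ} (hc : 0 ≤ c) :
    ∫ x, Real.exp (-(c / 2) * x ^ 2) ∂gaussianReal 0 1 = (1 + c) ^ (-(1 / 2) : ℝ) := by
  rw [integral_gaussianReal_eq_integral_smul one_ne_zero]
  have h (x : ℝ) : gaussianPDFReal 0 1 x • Real.exp (-(c / 2) * x ^ 2) =
      (√(2 * Real.pi))⁻¹ * Real.exp (-((1 + c) / 2) * x ^ 2) := by
    simp only [gaussianPDFReal, NNReal.coe_one, mul_one, sub_zero, smul_eq_mul]
    rw [mul_assoc, ← Real.exp_add]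
    ring_nf
  simp_rw [h]
  rw [integral_const_mul, integral_gaussian, ← Real.sqrt_inv, ← Real.sqrt_mul (by positivity),
    Real.rpow_neg (by positivity), ← Real.sqrt_eq_rpow, ← Real.sqrt_inv]
  congr 1
  field_simp

/-- Standard Gaussian vectors are invariant under the change to an orthonormal eigenbasis. -/
lemma measurePreserving_eigenvectorUnitary {p : ℕ} {Q : Matrix (Fin p) (Fin p) ℝ}
    (hQ : Q.IsHermitian) :
    MeasurePreserving (fun x : Fin p → ℝ => hQ.eigenvectorUnitary.1 *ᵥ x)
      (Measure.pi fun _ => gaussianReal 0 1) (Measure.pi fun _ => gaussianReal 0 1) := by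
  refine ⟨by fun_prop, ?_⟩
  have h := stdGaussian_eq_map_pi_orthonormalBasis hQ.eigenvectorBasis
  rw [← map_pi_eq_stdGaussian] at h
  have h' := congrArg (fun m => m.map (WithLp.ofLp (p := 2))) h
  simp only at h'
  rw [Measure.map_map (by fun_prop) (by fun_prop), Measure.map_map (by fun_prop) (by fun_prop)]
    at h'
  have e : (WithLp.ofLp (p := 2)) ∘ (WithLp.toLp 2 : (Fin p → ℝ) → _) = id := rfl
  rw [e, Measure.map_id] at h'
  conv_rhs => rw [h']
  congr 1
  ext x i
  simp [mulVec, dotProduct, mul_comm]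

lemma integral_exp_neg_quadratic {p k : ℕ} {Q : Matrix (Fin p) (Fin p) ℝ} (hT : Qᵀ = Q)
    (hQ : Q * Q = Q) (hk : Q.trace = k) {t : ℝ} (ht : 0 ≤ t) :
    ∫ x, Real.exp (-(t / 2) * (x ⬝ᵥ Q *ᵥ x)) ∂(Measure.pi fun _ : Fin p => gaussianReal 0 1) =
      (1 + t) ^ (-(k / 2) : ℝ) := by
  have hH : Q.IsHermitian := by rwa [IsHermitian, conjTranspose_eq_transpose_of_trivial]
  set U : Matrix (Fin p) (Fin p) ℝ := hH.eigenvectorUnitary.1 with hU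
  have hD : Uᵀ * Q * U = diagonal hH.eigenvalues := by
    have := hH.conjStarAlgAut_star_eigenvectorUnitary
    simpa [Unitary.conjStarAlgAut_apply, star_eq_conjTranspose] using this
  have hUU : U * Uᵀ = 1 := by
    have := Unitary.coe_mul_star_self hH.eigenvectorUnitary
    simpa [star_eq_conjTranspose] using this
  have hev (i) : hH.eigenvalues i = 0 ∨ hH.eigenvalues i = 1 := by
    have h2 : diagonal hH.eigenvalues * diagonal hH.eigenvalues = diagonal hH.eigenvalues := by
      rw [← hD]
      calc Uᵀ * Q * U * (Uᵀ * Q * U) = Uᵀ * Q * (U * Uᵀ) * Q * U := by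
            simp only [Matrix.mul_assoc]
        _ = Uᵀ * (Q * Q) * U := by rw [hUU]; simp only [Matrix.mul_assoc, Matrix.mul_one]
        _ = _ := by rw [hQ]
    have := congrFun (congrFun h2 i) i
    simp only [diagonal_mul_diagonal, diagonal_apply_eq] at this
    rcases eq_or_ne (hH.eigenvalues i) 0 with h | h
    · exact .inl h
    · exact .inr (mul_left_cancel₀ h (by simpa using this))
  have hsum : ∑ i, hH.eigenvalues i = k := by
    rw [← hk, hH.trace_eq_sum_eigenvalues]; simp
  have hquad (x : Fin p → ℝ) : (U *ᵥ x) ⬝ᵥ Q *ᵥ (U *ᵥ x) = ∑ i, hH.eigenvalues i * x i ^ 2 := by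
    rw [mulVec_mulVec, ← vecMul_transpose, ← dotProduct_mulVec, mulVec_mulVec, ← Matrix.mul_assoc,
      hD]
    simp only [dotProduct, mulVec_diagonal]
    exact Finset.sum_congr rfl fun i _ => by ring
  rw [← (measurePreserving_eigenvectorUnitary hH).map_eq, integral_map (by fun_prop)
    (Continuous.aestronglyMeasurable (by fun_prop))]
  simp_rw [← hU, hquad, Finset.mul_sum, Real.exp_sum]
  rw [integral_fintype_prod_eq_prod (fun i y => Real.exp (-(t / 2) * (hH.eigenvalues i * y ^ 2)))]
  have hfac (i) : ∫ y, Real.exp (-(t / 2) * (hH.eigenvalues i * y ^ 2)) ∂gaussianReal 0 1 =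
      (1 + t) ^ (-(1 / 2) * hH.eigenvalues i : ℝ) := by
    rcases hev i with h | h
    · simp [h]
    · simpa [h] using integral_exp_neg_sq_gaussianReal ht
  simp_rw [hfac]
  rw [← Real.rpow_sum_of_pos (by positivity), ← Finset.mul_sum, hsum]
  ring_nf

lemma quadratic_eq_dotProduct {p : ℕ} {Q : Matrix (Fin p) (Fin p) ℝ} (hT : Qᵀ = Q)
    (hQ : Q * Q = Q) (x : Fin p → ℝ) : x ⬝ᵥ Q *ᵥ x = (Q *ᵥ x) ⬝ᵥ (Q *ᵥ x) := by
  conv_lhs => rw [← hQ, ← mulVec_mulVec, dotProduct_mulVec, ← mulVec_transpose, hT]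

lemma quadratic_nonneg {p : ℕ} {Q : Matrix (Fin p) (Fin p) ℝ} (hT : Qᵀ = Q)
    (hQ : Q * Q = Q) (x : Fin p → ℝ) : 0 ≤ x ⬝ᵥ Q *ᵥ x := by
  rw [quadratic_eq_dotProduct hT hQ]
  exact Finset.sum_nonneg fun i _ => mul_self_nonneg _

lemma lintegral_exp_neg_half_mul {s : ℝ} (hs : 0 ≤ s) :
    ∫⁻ t in Set.Ioi (0 : ℝ), ENNReal.ofReal (1 / 2 * Real.exp (-(t / 2) * s)) =
      (ENNReal.ofReal s)⁻¹ := by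
  rcases hs.eq_or_lt with rfl | hs
  · simp [ENNReal.mul_top]
  have hE (t : ℝ) : -(t / 2) * s = -(s / 2) * t := by ring
  simp_rw [hE]
  rw [← ofReal_integral_eq_lintegral_ofReal
      ((integrableOn_exp_mul_Ioi (by linarith) 0).const_mul _) (ae_of_all _ fun t => by positivity),
    integral_const_mul, integral_exp_mul_Ioi (by linarith), ← ENNReal.ofReal_inv_of_pos hs]
  congr 1
  simp
  field_simp

lemma lintegral_one_add_rpow {k : ℕ} (hk : 3 ≤ k) :
    ∫⁻ t in Set.Ioi (0 : ℝ), ENNReal.ofReal (1 / 2 * (1 + t) ^ (-(k / 2) : ℝ)) =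
      ENNReal.ofReal (1 / ((k : ℝ) - 2)) := by
  have hk' : (3 : ℝ) ≤ k := by exact_mod_cast hk
  have hshift (f : ℝ → ENNReal) :
      ∫⁻ t in Set.Ioi (0 : ℝ), f (1 + t) = ∫⁻ t in Set.Ioi (1 : ℝ), f t := by
    have := (measurePreserving_add_left volume (1 : ℝ)).setLIntegral_comp_preimage_emb
      (measurableEmbedding_addLeft 1) f (Set.Ioi 1)
    simpa using this
  rw [hshift fun t => ENNReal.ofReal (1 / 2 * t ^ (-(k / 2) : ℝ)),
    ← ofReal_integral_eq_lintegral_ofReal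
      ((integrableOn_Ioi_rpow_of_lt (by linarith) one_pos).const_mul _)
      ((ae_restrict_iff' measurableSet_Ioi).2 (ae_of_all _ fun t (ht : 1 < t) => by
        have : 0 < t := by linarith
        positivity)),
    integral_const_mul, integral_Ioi_rpow_of_lt (by linarith) one_pos]
  congr 1
  rw [Real.one_rpow]
  have h1 : (k : ℝ) - 2 ≠ 0 := by linarith
  rw [show -((k : ℝ) / 2) + 1 = -((k - 2) / 2) by ring]
  field_simp

/-- The mean of the inverse chi-squared distribution with `k` degrees of freedom. -/
lemma lintegral_inv_quadratic {p k : ℕ} {Q : Matrix (Fin p) (Fin p) ℝ} (hT : Qᵀ = Q)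
    (hQ : Q * Q = Q) (hk : Q.trace = k) (hk3 : 3 ≤ k) :
    ∫⁻ x, (ENNReal.ofReal (x ⬝ᵥ Q *ᵥ x))⁻¹ ∂(Measure.pi fun _ : Fin p => gaussianReal 0 1) =
      ENNReal.ofReal (1 / ((k : ℝ) - 2)) := by
  simp_rw [← lintegral_exp_neg_half_mul (quadratic_nonneg hT hQ _)]
  rw [lintegral_lintegral_swap (Measurable.aemeasurable (by fun_prop)),
    ← lintegral_one_add_rpow hk3]
  refine setLIntegral_congr_fun measurableSet_Ioi fun t (ht : 0 < t) => ?_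
  have hi : Integrable (fun x => Real.exp (-(t / 2) * (x ⬝ᵥ Q *ᵥ x)))
      (Measure.pi fun _ : Fin p => gaussianReal 0 1) := by
    refine Integrable.of_bound (C := 1) (Continuous.aestronglyMeasurable (by fun_prop))
      (ae_of_all _ fun x => ?_)
    rw [Real.norm_eq_abs, Real.abs_exp, Real.exp_le_one_iff]
    have := quadratic_nonneg hT hQ x
    nlinarith
  rw [← ofReal_integral_eq_lintegral_ofReal (hi.const_mul _) (ae_of_all _ fun x => by positivity),
    integral_const_mul, integral_exp_neg_quadratic hT hQ hk ht.le]

/-- The matrix `1 - Mᵀ(MMᵀ)⁻¹M`; when `MMᵀ` is invertible, it is the orthogonal projection onto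
the orthogonal complement of the row space of `M`. -/
noncomputable def residualProj {m p : ℕ} (M : Matrix (Fin m) (Fin p) ℝ) :
    Matrix (Fin p) (Fin p) ℝ :=
  1 - Mᵀ * (M * Mᵀ)⁻¹ * M

section residualProj

variable {m p : ℕ} (M : Matrix (Fin m) (Fin p) ℝ)

lemma transpose_inv_gram : ((M * Mᵀ)⁻¹)ᵀ = (M * Mᵀ)⁻¹ := by
  simp [transpose_nonsing_inv]

lemma inv_gram_mul_gram_mul_inv_gram : (M * Mᵀ)⁻¹ * (M * Mᵀ) * (M * Mᵀ)⁻¹ = (M * Mᵀ)⁻¹ := by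
  by_cases h : IsUnit (M * Mᵀ).det
  · rw [nonsing_inv_mul _ h, Matrix.one_mul]
  · simp [nonsing_inv_apply_not_isUnit _ h]

lemma transpose_residualProj : (residualProj M)ᵀ = residualProj M := by
  simp [residualProj, transpose_inv_gram, Matrix.mul_assoc]

lemma residualProj_mul_transpose_mul_inv_gram :
    residualProj M * (Mᵀ * (M * Mᵀ)⁻¹) = 0 := by
  rw [residualProj, Matrix.sub_mul, Matrix.one_mul, sub_eq_zero]
  conv_lhs => rw [← inv_gram_mul_gram_mul_inv_gram]
  simp only [Matrix.mul_assoc]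

lemma residualProj_mul_self : residualProj M * residualProj M = residualProj M := by
  conv_lhs => enter [2]; rw [residualProj]
  rw [Matrix.mul_sub, Matrix.mul_one, ← Matrix.mul_assoc,
    residualProj_mul_transpose_mul_inv_gram, Matrix.zero_mul, sub_zero]

variable {M}

lemma trace_residualProj (h : (M * Mᵀ).det ≠ 0) : (residualProj M).trace = p - m := by
  rw [residualProj, trace_sub, Matrix.mul_assoc, trace_mul_comm, Matrix.mul_assoc,
    nonsing_inv_mul _ h.isUnit]
  simp

lemma det_gram_eq_mul {M : Matrix (Fin (m + 1)) (Fin p) ℝ} (j : Fin (m + 1))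
    {N : Matrix (Fin m) (Fin p) ℝ} (hN : N = M.submatrix j.succAbove id)
    (h : (N * Nᵀ).det ≠ 0) :
    (M * Mᵀ).det = (N * Nᵀ).det * (M j ⬝ᵥ residualProj N *ᵥ M j) := by
  let e : Fin m ⊕ Unit ≃ Fin (m + 1) :=
    (Equiv.optionEquivSumPUnit (Fin m)).symm.trans (finSuccEquiv' j).symm
  have hel (i) : e (.inl i) = j.succAbove i := by simp [e]
  have her : e (.inr ()) = j := by simp [e]
  let B : Matrix (Fin m) Unit ℝ := N * (of fun _ : Unit => M j)ᵀ
  have hblock : (M * Mᵀ).submatrix e e =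
      fromBlocks (N * Nᵀ) B Bᵀ ((of fun _ : Unit => M j) * (of fun _ : Unit => M j)ᵀ) := by
    ext (a | a) (b | b) <;>
      simp [hel, her, hN, B, mul_apply, mul_comm]
  let := invertibleOfIsUnitDet _ h.isUnit
  rw [← det_submatrix_equiv_self e, hblock, det_fromBlocks₁₁, invOf_eq_nonsing_inv]
  congr 1
  have : (of fun _ : Unit => M j) * (of fun _ : Unit => M j)ᵀ - Bᵀ * (N * Nᵀ)⁻¹ * B =
      (of fun _ : Unit => M j) * (residualProj N * (of fun _ : Unit => M j)ᵀ) := by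
    simp [B, residualProj, Matrix.sub_mul, Matrix.mul_sub, Matrix.mul_assoc]
  rw [this, det_unique]
  rfl

lemma inv_gram_apply_self {M : Matrix (Fin (m + 1)) (Fin p) ℝ} (j : Fin (m + 1))
    {N : Matrix (Fin m) (Fin p) ℝ} (hN : N = M.submatrix j.succAbove id)
    (h : (N * Nᵀ).det ≠ 0) :
    (M * Mᵀ)⁻¹ j j = (M j ⬝ᵥ residualProj N *ᵥ M j)⁻¹ := by
  have hsub : (M * Mᵀ).submatrix j.succAbove j.succAbove = N * Nᵀ := by
    rw [hN]; rfl
  rw [inv_def, Matrix.smul_apply, adjugate_fin_succ_eq_det_submatrix, hsub, det_gram_eq_mul j hN h,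
    Ring.inverse_eq_inv', smul_eq_mul, Even.neg_one_pow ⟨_, rfl⟩]
  field_simp

lemma inv_gram_posSemidef : ((M * Mᵀ)⁻¹).PosSemidef := by
  have := posSemidef_self_mul_conjTranspose M
  rw [conjTranspose_eq_transpose_of_trivial] at this
  exact this.inv

lemma residualProj_posSemidef : (residualProj M).PosSemidef := by
  have := posSemidef_self_mul_conjTranspose (residualProj M)
  rwa [conjTranspose_eq_transpose_of_trivial, transpose_residualProj,
    residualProj_mul_self] at this

/-- The pointwise bias-variance decomposition of the minimum-norm interpolator. -/
lemma sum_sq_error_eq (w : Fin p → ℝ) (z : Fin m → ℝ) :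
    ∑ i, (((Mᵀ * (M * Mᵀ)⁻¹) *ᵥ (M *ᵥ w + z)) i - w i) ^ 2 =
      w ⬝ᵥ residualProj M *ᵥ w + z ⬝ᵥ (M * Mᵀ)⁻¹ *ᵥ z := by
  set A := Mᵀ * (M * Mᵀ)⁻¹ with hA
  set Q := residualProj M with hQ
  have hQA : Q * A = 0 := residualProj_mul_transpose_mul_inv_gram M
  have hAA : Aᵀ * A = (M * Mᵀ)⁻¹ := by
    rw [hA, transpose_mul, transpose_inv_gram, transpose_transpose]
    conv_rhs => rw [← inv_gram_mul_gram_mul_inv_gram]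
    simp only [Matrix.mul_assoc]
  have hQQ : Qᵀ * Q = Q := by rw [transpose_residualProj, residualProj_mul_self]
  have hv : A *ᵥ (M *ᵥ w + z) - w = A *ᵥ z - Q *ᵥ w := by
    rw [mulVec_add, mulVec_mulVec, hQ, residualProj, sub_mulVec, one_mulVec]
    abel
  calc _ = (A *ᵥ (M *ᵥ w + z) - w) ⬝ᵥ (A *ᵥ (M *ᵥ w + z) - w) := by
        simp [dotProduct, sq]
    _ = (A *ᵥ z) ⬝ᵥ (A *ᵥ z) - 2 * ((A *ᵥ z) ⬝ᵥ (Q *ᵥ w)) + (Q *ᵥ w) ⬝ᵥ (Q *ᵥ w) := by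
        rw [hv, sub_dotProduct, dotProduct_sub, dotProduct_sub, dotProduct_comm (Q *ᵥ w) (A *ᵥ z)]
        ring
    _ = _ := by
        rw [dotProduct_mulVec (A *ᵥ z) Q w, ← mulVec_transpose, transpose_residualProj, ← hQ,
          mulVec_mulVec, hQA, zero_mulVec, zero_dotProduct, dotProduct_mulVec _ A,
          ← mulVec_transpose, mulVec_mulVec, hAA, dotProduct_mulVec _ Q, ← mulVec_transpose,
          mulVec_mulVec, hQQ, dotProduct_comm _ w, dotProduct_comm _ z]
        ring

end residualProj

lemma Matrix.PosSemidef.abs_apply_le {n : ℕ} {A : Matrix (Fin n) (Fin n) ℝ} (hA : A.PosSemidef)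
    (j k : Fin n) : |A j k| ≤ A j j + A k k := by
  have hs : A k j = A j k := by simpa using hA.isHermitian.apply j k
  have hq (c : ℝ) : 0 ≤ A j j + 2 * c * A j k + c ^ 2 * A k k := by
    have h := hA.dotProduct_mulVec_nonneg (Pi.single j 1 + c • Pi.single k 1)
    simp [mulVec_add, mulVec_smul, hs] at h
    nlinarith
  have h1 := hq 1
  have h2 := hq (-1)
  have h3 : 0 ≤ A j j := by simpa using hq 0
  have h4 : 0 ≤ A k k := hA.diag_nonneg
  rw [abs_le]
  constructor <;> nlinarith

instance (p n : ℕ) : IsProbabilityMeasure (stdGaussianMatrix p n) := by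
  unfold stdGaussianMatrix; infer_instance

instance (n : ℕ) (σ : ℝ≥0) : IsProbabilityMeasure (gaussianNoise n σ) := by
  unfold gaussianNoise; infer_instance

lemma measurable_inv_gram_apply {n p : ℕ} (j k : Fin n) :
    Measurable fun c : Fin n → Fin p → ℝ => (of c * (of c)ᵀ)⁻¹ j k := by
  have hG : Continuous fun c : Fin n → Fin p → ℝ => of c * (of c)ᵀ := by
    refine continuous_matrix fun a b => ?_
    simp only [mul_apply, of_apply, transpose_apply]
    fun_prop
  simp_rw [inv_def, Matrix.smul_apply, Ring.inverse_eq_inv', smul_eq_mul]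
  exact hG.matrix_det.measurable.inv.mul (hG.matrix_adjugate.matrix_elem j k).measurable

lemma measurable_residualProj_apply {n p : ℕ} (i k : Fin p) :
    Measurable fun c : Fin n → Fin p → ℝ => residualProj (of c) i k := by
  simp only [residualProj, Matrix.sub_apply, mul_apply (M := _ * _), mul_apply (N := _⁻¹),
    transpose_apply, of_apply]
  refine measurable_const.sub (Finset.measurable_sum _ fun a _ => ?_)
  refine (Finset.measurable_sum _ fun b _ => ?_).mul (by fun_prop)
  exact Measurable.mul (by fun_prop) (measurable_inv_gram_apply b a)

lemma lintegral_stdGaussianMatrix_succ {m p : ℕ} (j : Fin (m + 1))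
    {f : (Fin (m + 1) → Fin p → ℝ) → ENNReal} (hf : Measurable f) :
    ∫⁻ c, f c ∂stdGaussianMatrix (m + 1) p =
      ∫⁻ c, ∫⁻ x, f (j.insertNth x c) ∂(Measure.pi fun _ => gaussianReal 0 1)
        ∂stdGaussianMatrix m p := by
  have h := (measurePreserving_piFinSuccAbove
    (fun _ : Fin (m + 1) => Measure.pi fun _ : Fin p => gaussianReal 0 1) j).symm
  have hmap := h.lintegral_comp hf
  rw [stdGaussianMatrix, ← hmap]
  exact lintegral_prod_symm _ (Measurable.aemeasurable (hf.comp h.measurable))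

lemma of_insertNth_submatrix {m p : ℕ} (j : Fin (m + 1)) (x : Fin p → ℝ) (c : Fin m → Fin p → ℝ) :
    of c = (of (j.insertNth x c : Fin (m + 1) → Fin p → ℝ)).submatrix j.succAbove id := by
  ext a b; simp

lemma of_insertNth_self {m p : ℕ} (j : Fin (m + 1)) (x : Fin p → ℝ) (c : Fin m → Fin p → ℝ) :
    of (j.insertNth x c : Fin (m + 1) → Fin p → ℝ) j = x :=
  Fin.insertNth_apply_same (α := fun _ => Fin p → ℝ) j x c

lemma lintegral_inv_residual {m p : ℕ} (hp : m + 3 ≤ p) {N : Matrix (Fin m) (Fin p) ℝ}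
    (hN : (N * Nᵀ).det ≠ 0) :
    ∫⁻ x, (ENNReal.ofReal (x ⬝ᵥ residualProj N *ᵥ x))⁻¹
        ∂(Measure.pi fun _ : Fin p => gaussianReal 0 1) =
      ENNReal.ofReal (1 / ((p : ℝ) - m - 2)) := by
  have hk : (residualProj N).trace = ((p - m : ℕ) : ℝ) := by
    rw [trace_residualProj hN, Nat.cast_sub (by omega)]
  rw [lintegral_inv_quadratic (transpose_residualProj N) (residualProj_mul_self N) hk (by omega),
    Nat.cast_sub (by omega)]

lemma ae_residual_pos {m p : ℕ} (hp : m + 3 ≤ p) {N : Matrix (Fin m) (Fin p) ℝ}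
    (hN : (N * Nᵀ).det ≠ 0) :
    ∀ᵐ x ∂(Measure.pi fun _ : Fin p => gaussianReal 0 1), 0 < x ⬝ᵥ residualProj N *ᵥ x := by
  have h := ae_lt_top' (μ := Measure.pi fun _ : Fin p => gaussianReal 0 1)
    (f := fun x => (ENNReal.ofReal (x ⬝ᵥ residualProj N *ᵥ x))⁻¹)
    (Measurable.aemeasurable (by fun_prop)) (by simp [lintegral_inv_residual hp hN])
  filter_upwards [h] with x hx
  simpa using hx

/-- A short enough family of independent Gaussian vectors is almost surely linearly independent. -/
lemma ae_det_gram_ne_zero {p : ℕ} (m : ℕ) (hp : m + 2 ≤ p) :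
    ∀ᵐ c ∂stdGaussianMatrix m p, (of c * (of c)ᵀ).det ≠ 0 := by
  induction m with
  | zero => simp
  | succ m ih =>
    have hms : MeasurableSet {c : Fin (m + 1) → Fin p → ℝ | (of c * (of c)ᵀ).det = 0} := by
      refine IsClosed.measurableSet (isClosed_eq (Continuous.matrix_det ?_) continuous_const)
      refine continuous_matrix fun a b => ?_
      simp only [mul_apply, of_apply, transpose_apply]
      fun_prop
    have hset : {c : Fin (m + 1) → Fin p → ℝ | ¬ (of c * (of c)ᵀ).det ≠ 0} =
        {c | (of c * (of c)ᵀ).det = 0} := by simp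
    rw [ae_iff, hset, ← lintegral_indicator_one hms,
      lintegral_stdGaussianMatrix_succ 0 (measurable_one.indicator hms)]
    refine lintegral_eq_zero_of_ae_eq_zero ?_
    filter_upwards [ih (by omega)] with c hc
    refine lintegral_eq_zero_of_ae_eq_zero ?_
    filter_upwards [ae_residual_pos (by omega) hc] with x hx
    have hd := det_gram_eq_mul 0 (of_insertNth_submatrix 0 x c) hc
    rw [of_insertNth_self] at hd
    refine Set.indicator_of_notMem ?_ _
    simp only [Set.mem_ofPred_eq, hd]
    exact mul_ne_zero hc hx.ne'

lemma lintegral_inv_gram_apply_self {n p : ℕ} (hp : n + 2 ≤ p) (j : Fin n) :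
    ∫⁻ c, ENNReal.ofReal ((of c * (of c)ᵀ)⁻¹ j j) ∂stdGaussianMatrix n p =
      ENNReal.ofReal (1 / ((p : ℝ) - n - 1)) := by
  obtain _ | m := n
  · exact j.elim0
  rw [lintegral_stdGaussianMatrix_succ j (measurable_inv_gram_apply j j).ennreal_ofReal]
  trans ∫⁻ _, ENNReal.ofReal (1 / ((p : ℝ) - (m + 1 : ℕ) - 1)) ∂stdGaussianMatrix m p
  · refine lintegral_congr_ae ?_
    filter_upwards [ae_det_gram_ne_zero m (by omega)] with c hc
    rw [show (p : ℝ) - (m + 1 : ℕ) - 1 = p - m - 2 by push_cast; ring,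
      ← lintegral_inv_residual (by omega) hc]
    refine lintegral_congr_ae ?_
    filter_upwards [ae_residual_pos (by omega) hc] with x hx
    rw [inv_gram_apply_self j (of_insertNth_submatrix j x c) hc, of_insertNth_self,
      ENNReal.ofReal_inv_of_pos hx]
  · simp

lemma integrable_inv_gram_apply {n p : ℕ} (hp : n + 2 ≤ p) (j k : Fin n) :
    Integrable (fun c => (of c * (of c)ᵀ)⁻¹ j k) (stdGaussianMatrix n p) := by
  have hdiag (j : Fin n) : Integrable (fun c => (of c * (of c)ᵀ)⁻¹ j j)
      (stdGaussianMatrix n p) := by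
    refine ⟨(measurable_inv_gram_apply j j).aestronglyMeasurable, ?_⟩
    rw [hasFiniteIntegral_iff_ofReal (ae_of_all _ fun c => inv_gram_posSemidef.diag_nonneg),
      lintegral_inv_gram_apply_self hp]
    exact ENNReal.ofReal_lt_top
  exact ((hdiag j).add (hdiag k)).mono' (measurable_inv_gram_apply j k).aestronglyMeasurable
    (ae_of_all _ fun c => inv_gram_posSemidef.abs_apply_le j k)

lemma integral_inv_gram_apply_self {n p : ℕ} (hp : n + 2 ≤ p) (j : Fin n) :
    ∫ c, (of c * (of c)ᵀ)⁻¹ j j ∂stdGaussianMatrix n p = 1 / ((p : ℝ) - n - 1) := by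
  have hp' : (n : ℝ) + 2 ≤ p := by exact_mod_cast hp
  rw [integral_eq_lintegral_of_nonneg_ae (ae_of_all _ fun c => inv_gram_posSemidef.diag_nonneg)
      (measurable_inv_gram_apply j j).aestronglyMeasurable,
    lintegral_inv_gram_apply_self hp, ENNReal.toReal_ofReal]
  exact one_div_nonneg.2 (by linarith)

lemma residualProj_mul_orthogonal {n p : ℕ} (M : Matrix (Fin n) (Fin p) ℝ)
    {U : Matrix (Fin p) (Fin p) ℝ} (hU : U * Uᵀ = 1) :
    residualProj (M * U) = Uᵀ * residualProj M * U := by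
  have hU' : Uᵀ * U = 1 := mul_eq_one_comm.1 hU
  have hG : M * U * (M * U)ᵀ = M * Mᵀ := by
    rw [transpose_mul, Matrix.mul_assoc, ← Matrix.mul_assoc U, hU, Matrix.one_mul]
  rw [residualProj, hG, residualProj, Matrix.mul_sub, Matrix.sub_mul, Matrix.mul_one, hU',
    transpose_mul]
  simp only [Matrix.mul_assoc]

lemma residualProj_submatrix {n p : ℕ} (M : Matrix (Fin n) (Fin p) ℝ) (e : Equiv.Perm (Fin p)) :
    residualProj (M.submatrix id e) = (residualProj M).submatrix e e := by
  have hG : M.submatrix id e * (M.submatrix id e)ᵀ = M * Mᵀ := by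
    rw [transpose_submatrix, submatrix_mul_equiv, submatrix_id_id]
  rw [residualProj, hG, residualProj, submatrix_sub, Pi.sub_apply, Pi.sub_apply,
    submatrix_one_equiv]
  rfl

lemma abs_residualProj_apply_le {n p : ℕ} (M : Matrix (Fin n) (Fin p) ℝ) (i k : Fin p) :
    |residualProj M i k| ≤ 2 := by
  have hdiag (i) : residualProj M i i ≤ 1 := by
    have h : residualProj M i i = ∑ k, residualProj M i k ^ 2 := by
      have h := congrFun (congrFun (residualProj_mul_self M) i) i
      have ht (k) : residualProj M k i = residualProj M i k :=
        congrFun (congrFun (transpose_residualProj M) i) k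
      simpa [mul_apply, ht, sq] using h.symm
    have := Finset.single_le_sum (f := fun k => residualProj M i k ^ 2)
      (fun k _ => sq_nonneg _) (Finset.mem_univ i)
    nlinarith
  linarith [residualProj_posSemidef.abs_apply_le (A := residualProj M) i k, hdiag i, hdiag k]

lemma integrable_residualProj_apply {n p : ℕ} (i k : Fin p) :
    Integrable (fun c => residualProj (of c) i k) (stdGaussianMatrix n p) :=
  .of_bound (measurable_residualProj_apply i k).aestronglyMeasurable 2
    (ae_of_all _ fun _ => abs_residualProj_apply_le _ i k)

lemma integral_residualProj_apply_of_ne {n p : ℕ} {i k : Fin p} (h : i ≠ k) :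
    ∫ c, residualProj (of c) i k ∂stdGaussianMatrix n p = 0 := by
  let s : Fin p → ℝ := fun a => if a = i then -1 else 1
  have hs (a) : s a = 1 ∨ s a = -1 := by by_cases h : a = i <;> simp [s, h]
  have hmp : MeasurePreserving (fun (c : Fin n → Fin p → ℝ) a b => c a b * s b)
      (stdGaussianMatrix n p) (stdGaussianMatrix n p) := by
    refine measurePreserving_pi _ _ (f := fun _ (x : Fin p → ℝ) b => x b * s b) fun _ =>
      measurePreserving_pi _ _ (f := fun b y => y * s b) fun b => ⟨by fun_prop, ?_⟩
    rw [gaussianReal_map_mul_const]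
    rcases hs b with h | h <;> simp [h]
  have hD : diagonal s * (diagonal s)ᵀ = 1 := by
    rw [diagonal_transpose, diagonal_mul_diagonal, ← diagonal_one]
    congr 1
    ext b
    rcases hs b with h | h <;> simp [h]
  have key (c : Fin n → Fin p → ℝ) :
      residualProj (of fun a b => c a b * s b) i k = - residualProj (of c) i k := by
    have : (of fun a b => c a b * s b) = of c * diagonal s := by
      ext a b; simp
    rw [this, residualProj_mul_orthogonal _ hD]
    simp [s, h.symm]
  have hint := integral_map hmp.aemeasurable
    (measurable_residualProj_apply i k).aestronglyMeasurable (μ := stdGaussianMatrix n p)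
  rw [hmp.map_eq] at hint
  simp_rw [key, integral_neg] at hint
  linarith

lemma integral_residualProj_apply_self_eq {n p : ℕ} (i k : Fin p) :
    ∫ c, residualProj (of c) i i ∂stdGaussianMatrix n p =
      ∫ c, residualProj (of c) k k ∂stdGaussianMatrix n p := by
  let e := Equiv.swap i k
  have hmp : MeasurePreserving (fun (c : Fin n → Fin p → ℝ) a b => c a (e b))
      (stdGaussianMatrix n p) (stdGaussianMatrix n p) := by
    refine measurePreserving_pi _ _ (f := fun _ (x : Fin p → ℝ) b => x (e b)) fun _ => ?_
    have h := measurePreserving_piCongrLeft (α := fun _ => ℝ)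
      (fun _ : Fin p => gaussianReal 0 1) e.symm
    convert h using 1
    ext x b
    simp [MeasurableEquiv.coe_piCongrLeft, Equiv.piCongrLeft_apply]
  have key (c : Fin n → Fin p → ℝ) :
      residualProj (of fun a b => c a (e b)) k k = residualProj (of c) i i := by
    have : (of fun a b => c a (e b)) = (of c).submatrix id e := rfl
    simp [this, residualProj_submatrix, e]
  have hint := integral_map hmp.aemeasurable
    (measurable_residualProj_apply k k).aestronglyMeasurable (μ := stdGaussianMatrix n p)
  rw [hmp.map_eq] at hint
  simp_rw [key] at hint
  exact hint.symm

lemma integral_residualProj_apply_self {n p : ℕ} (hp : n + 2 ≤ p) (i : Fin p) :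
    ∫ c, residualProj (of c) i i ∂stdGaussianMatrix n p = 1 - (n : ℝ) / p := by
  have hsum : ∑ k, ∫ c, residualProj (of c) k k ∂stdGaussianMatrix n p = (p : ℝ) - n := by
    rw [← integral_finsetSum _ fun k _ => integrable_residualProj_apply k k]
    trans ∫ _, ((p : ℝ) - n) ∂stdGaussianMatrix n p
    · refine integral_congr_ae ?_
      filter_upwards [ae_det_gram_ne_zero n hp] with c hc
      exact trace_residualProj hc
    · simp
  simp_rw [integral_residualProj_apply_self_eq (n := n) _ i] at hsum
  have hp0 : (p : ℝ) ≠ 0 := by norm_cast; omega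
  simp at hsum
  field_simp
  linarith

lemma measurePreserving_swap_stdGaussianMatrix (p n : ℕ) :
    MeasurePreserving (fun (c : Fin p → Fin n → ℝ) a b => c b a)
      (stdGaussianMatrix p n) (stdGaussianMatrix n p) := by
  refine ⟨by fun_prop, Eq.symm ?_⟩
  refine Measure.pi_eq_generateFrom (C := fun _ =>
    Set.univ.pi '' Set.univ.pi fun _ : Fin p => {s : Set ℝ | MeasurableSet s})
    (fun _ => generateFrom_pi) (fun _ => isPiSystem_pi)
    (fun _ => .pi fun _ => (gaussianReal 0 1).toFiniteSpanningSetsIn) fun s hs => ?_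
  choose t ht hts using hs
  obtain rfl : (fun a => Set.univ.pi (t a)) = s := funext hts
  have hpre : (fun (c : Fin p → Fin n → ℝ) a b => c b a) ⁻¹'
      (Set.univ.pi fun a => Set.univ.pi (t a)) =
      Set.univ.pi fun b => Set.univ.pi fun a => t a b := by
    ext c; simp [forall_comm (α := Fin n)]
  rw [Measure.map_apply (by fun_prop)
    (.univ_pi fun a => .univ_pi fun b => show MeasurableSet (t a b) from ht a b trivial), hpre,
    stdGaussianMatrix]
  simp_rw [Measure.pi_pi]
  exact Finset.prod_comm

lemma integral_residual_quadratic {n p : ℕ} (hp : n + 2 ≤ p) (w : Fin p → ℝ) :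
    ∫ c, w ⬝ᵥ residualProj (of c) *ᵥ w ∂stdGaussianMatrix n p =
      (1 - (n : ℝ) / p) * ∑ i, w i ^ 2 := by
  simp only [dotProduct, mulVec, Finset.mul_sum]
  rw [integral_finsetSum _ fun i _ => integrable_finsetSum _ fun k _ =>
    ((integrable_residualProj_apply i k).mul_const _).const_mul _]
  refine Finset.sum_congr rfl fun i _ => ?_
  rw [integral_finsetSum _ fun k _ => ((integrable_residualProj_apply i k).mul_const _).const_mul _,
    Finset.sum_eq_single i]
  · rw [integral_const_mul, integral_mul_const, integral_residualProj_apply_self hp]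
    ring
  · intro k _ hk
    rw [integral_const_mul, integral_mul_const, integral_residualProj_apply_of_ne hk.symm]
    ring
  · simp

lemma integrable_residual_quadratic {n p : ℕ} (w : Fin p → ℝ) :
    Integrable (fun c => w ⬝ᵥ residualProj (of c) *ᵥ w) (stdGaussianMatrix n p) := by
  simp only [dotProduct, mulVec, Finset.mul_sum]
  exact integrable_finsetSum _ fun i _ => integrable_finsetSum _ fun k _ =>
    ((integrable_residualProj_apply i k).mul_const _).const_mul _

lemma memLp_eval_gaussianNoise {n : ℕ} (σ : ℝ≥0) (j : Fin n) :
    MemLp (fun z : Fin n → ℝ => z j) 2 (gaussianNoise n σ) :=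
  (memLp_id_gaussianReal 2).comp_measurePreserving (measurePreserving_eval _ j)

lemma integral_mul_gaussianNoise {n : ℕ} (σ : ℝ≥0) (j k : Fin n) :
    ∫ z, z j * z k ∂gaussianNoise n σ = if j = k then (σ : ℝ) ^ 2 else 0 := by
  have hmap (j : Fin n) : (gaussianNoise n σ).map (fun z => z j) = gaussianReal 0 (σ ^ 2) :=
    (measurePreserving_eval _ j).map_eq
  have hmean (j : Fin n) : ∫ z, z j ∂gaussianNoise n σ = 0 := by
    rw [← integral_map (φ := fun z : Fin n → ℝ => z j) (f := fun y => y)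
      (measurable_pi_apply j).aemeasurable (by fun_prop), hmap,
      integral_id_gaussianReal]
  split_ifs with h
  · subst h
    have hv := variance_fun_id_gaussianReal (μ := 0) (v := σ ^ 2)
    rw [variance_of_integral_eq_zero (by fun_prop) integral_id_gaussianReal, ← hmap j,
      integral_map (measurable_pi_apply j).aemeasurable (by fun_prop)] at hv
    simpa [sq] using hv
  · have hi : IndepFun (fun z : Fin n → ℝ => z j) (fun z => z k) (gaussianNoise n σ) :=
      (iIndepFun_pi (X := fun _ : Fin n => (id : ℝ → ℝ)) (fun _ => aemeasurable_id)).indepFun h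
    rw [hi.integral_fun_mul_eq_mul_integral (measurable_pi_apply j).aestronglyMeasurable
      (measurable_pi_apply k).aestronglyMeasurable, hmean, zero_mul]

lemma integrable_noise_quadratic {n p : ℕ} (hp : n + 2 ≤ p) (σ : ℝ≥0) (j k : Fin n) :
    Integrable (fun ω : (Fin n → Fin p → ℝ) × (Fin n → ℝ) =>
      (of ω.1 * (of ω.1)ᵀ)⁻¹ j k * (ω.2 j * ω.2 k))
      ((stdGaussianMatrix n p).prod (gaussianNoise n σ)) :=
  (integrable_inv_gram_apply hp j k).mul_prod
    ((memLp_eval_gaussianNoise σ j).integrable_mul (memLp_eval_gaussianNoise σ k))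

lemma noise_quadratic_eq_sum {n : ℕ} (A : Matrix (Fin n) (Fin n) ℝ) (z : Fin n → ℝ) :
    z ⬝ᵥ A *ᵥ z = ∑ j, ∑ k, A j k * (z j * z k) := by
  simp only [dotProduct, mulVec, Finset.mul_sum]
  exact Finset.sum_congr rfl fun j _ => Finset.sum_congr rfl fun k _ => by ring

lemma integral_noise_quadratic {n p : ℕ} (hp : n + 2 ≤ p) (σ : ℝ≥0) :
    ∫ ω : (Fin n → Fin p → ℝ) × (Fin n → ℝ), ω.2 ⬝ᵥ (of ω.1 * (of ω.1)ᵀ)⁻¹ *ᵥ ω.2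
      ∂(stdGaussianMatrix n p).prod (gaussianNoise n σ) =
      n * (σ : ℝ) ^ 2 / ((p : ℝ) - n - 1) := by
  simp_rw [noise_quadratic_eq_sum]
  rw [integral_finsetSum _ fun j _ => integrable_finsetSum _ fun k _ =>
    integrable_noise_quadratic hp σ j k]
  simp_rw [integral_finsetSum _ fun k _ => integrable_noise_quadratic hp σ _ k]
  have hterm (j k : Fin n) := integral_prod_mul (μ := stdGaussianMatrix n p)
    (ν := gaussianNoise n σ) (fun c => (of c * (of c)ᵀ)⁻¹ j k) (fun z => z j * z k)
  simp_rw [hterm, integral_mul_gaussianNoise, mul_ite, mul_zero, Finset.sum_ite_eq,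
    Finset.mem_univ, if_true, integral_inv_gram_apply_self hp]
  simp
  ring

/-- **Single-task learning, overparameterized regime.** For `p ≥ n + 2`, data `X` with
i.i.d. `N(0,1)` entries, noise `z` with i.i.d. `N(0,σ²)` entries, labels `y = Xᵀw* + z`, and
minimum-`ℓ₂`-norm interpolator `w = X(XᵀX)⁻¹y`, the expected generalization error is
`E[‖w − w*‖₂²] = (1 − n/p)·‖w*‖₂² + n·σ²/(p − n − 1)`. -/
theorem single_task_overparam {p n : ℕ} (hn : 1 ≤ n) (σ : ℝ≥0) (wstar : Fin p → ℝ)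
    (hp : n + 2 ≤ p) :
    (∫ ω : (Fin p → Fin n → ℝ) × (Fin n → ℝ),
        (let X := Matrix.of ω.1
         let y := Xᵀ *ᵥ wstar + ω.2
         let w := (X * (Xᵀ * X)⁻¹) *ᵥ y
         ∑ i, (w i - wstar i) ^ 2)
        ∂((stdGaussianMatrix p n).prod (gaussianNoise n σ))) =
      (1 - (n : ℝ) / (p : ℝ)) * (∑ i, wstar i ^ 2) +
        (n : ℝ) * (σ : ℝ) ^ 2 / ((p : ℝ) - (n : ℝ) - 1) := by
  let μ := (stdGaussianMatrix n p).prod (gaussianNoise n σ)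
  let g : (Fin n → Fin p → ℝ) × (Fin n → ℝ) → ℝ := fun ω =>
    wstar ⬝ᵥ residualProj (of ω.1) *ᵥ wstar + ω.2 ⬝ᵥ (of ω.1 * (of ω.1)ᵀ)⁻¹ *ᵥ ω.2
  have hmp := (measurePreserving_swap_stdGaussianMatrix p n).prod
    (MeasurePreserving.id (gaussianNoise n σ))
  have hbias : Integrable (fun ω : (Fin n → Fin p → ℝ) × (Fin n → ℝ) =>
      wstar ⬝ᵥ residualProj (of ω.1) *ᵥ wstar) μ :=
    (integrable_residual_quadratic wstar).comp_fst _
  have hvar : Integrable (fun ω : (Fin n → Fin p → ℝ) × (Fin n → ℝ) =>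
      ω.2 ⬝ᵥ (of ω.1 * (of ω.1)ᵀ)⁻¹ *ᵥ ω.2) μ := by
    simp_rw [noise_quadratic_eq_sum]
    exact integrable_finsetSum _ fun j _ => integrable_finsetSum _ fun k _ =>
      integrable_noise_quadratic hp σ j k
  have hg : ∫ ω, g ω ∂μ = (1 - (n : ℝ) / (p : ℝ)) * (∑ i, wstar i ^ 2) +
      (n : ℝ) * (σ : ℝ) ^ 2 / ((p : ℝ) - (n : ℝ) - 1) := by
    rw [integral_add hbias hvar, integral_noise_quadratic hp,
      integral_fun_fst (fun c => wstar ⬝ᵥ residualProj (of c) *ᵥ wstar),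
      integral_residual_quadratic hp]
    simp
  have hchange := integral_map (f := g) hmp.aemeasurable
    (hmp.map_eq.symm ▸ (hbias.add hvar).aestronglyMeasurable)
  rw [hmp.map_eq] at hchange
  rw [← hg]
  refine Eq.trans (integral_congr_ae (ae_of_all _ fun ω => ?_)) hchange.symm
  have h := sum_sq_error_eq (M := (of ω.1)ᵀ) wstar ω.2
  rw [transpose_transpose] at h
  exact h
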